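/- arXiv:2505.15788 — 4 statements merged into one kernel-verified Lean document; each statement's English description precedes it below -/
import Mathlib

section
/- Let N, N₀, N₁ be positive integers with N₀ + N₁ = N, let s_i ∈ {0,1} for i ∈ [N] with exactly N₁ indices satisfying s_i = 1 and N₀ indices satisfying s_i = 0, let v_i ∈ ℝ for i ∈ [N], and let τ ∈ ℝ. Define s̄ = (1/N)·Σ_{i ∈ [N]} s_i. Then the covariance surrogate c_cov = (1/N)·Σ_{i ∈ [N]} (s_i − s̄)·v_i satisfies c_cov = (N₀·N₁/N²)·c_dp^lin, where c_dp^lin = (1/N₁)·Σ_{i : s_i = 1} (v_i − τ) − (1/N₀)·Σ_{i : s_i = 0} (v_i − τ) is the demographic-parity surrogate obtained with the linear surrogate φ(t) = t applied to the shifted scores t_i = v_i − τ. -/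
open Finset

/-- Theorem 2 of the paper: the covariance surrogate is proportional to the
linear demographic-parity surrogate, with proportionality constant N₀·N₁/N². -/
theorem covariance_proportional_linear_dp
    (N N₀ N₁ : ℕ) (hN : 0 < N) (hN₀ : 0 < N₀) (hN₁ : 0 < N₁)
    (hsum : N₀ + N₁ = N)
    (s : Fin N → ℕ) (hs : ∀ i, s i = 0 ∨ s i = 1)
    (hcard1 : (Finset.univ.filter (fun i => s i = 1)).card = N₁)
    (hcard0 : (Finset.univ.filter (fun i => s i = 0)).card = N₀)
    (v : Fin N → ℝ) (τ : ℝ) :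
    (1 / (N : ℝ)) * ∑ i, ((s i : ℝ) - (1 / (N : ℝ)) * ∑ j, (s j : ℝ)) * v i
      = ((N₀ : ℝ) * (N₁ : ℝ) / (N : ℝ) ^ 2)
        * ((∑ i ∈ Finset.univ.filter (fun i => s i = 1), (v i - τ)) / (N₁ : ℝ)
            - (∑ i ∈ Finset.univ.filter (fun i => s i = 0), (v i - τ)) / (N₀ : ℝ)) := by
  have e1 : ∀ f : Fin N → ℝ, ∑ i, (s i : ℝ) * f i
      = ∑ i ∈ Finset.univ.filter (fun i => s i = 1), f i := by
    intro f
    rw [Finset.sum_filter]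
    refine Finset.sum_congr rfl fun i _ => ?_
    rcases hs i with h | h <;> simp [h]
  have e2 : ∑ i, v i = ∑ i ∈ Finset.univ.filter (fun i => s i = 1), v i
      + ∑ i ∈ Finset.univ.filter (fun i => s i = 0), v i := by
    rw [Finset.sum_filter, Finset.sum_filter, ← Finset.sum_add_distrib]
    refine Finset.sum_congr rfl fun i _ => ?_
    rcases hs i with h | h <;> simp [h]
  have e3 : ∑ j, (s j : ℝ) = N₁ := by
    have h := e1 (fun _ => 1)
    simpa [hcard1] using h
  have h0 : (N₀ : ℝ) ≠ 0 := by positivity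
  have h1 : (N₁ : ℝ) ≠ 0 := by positivity
  have hNR : (N : ℝ) ≠ 0 := by positivity
  have hS : (N : ℝ) = N₀ + N₁ := by rw [← hsum]; push_cast; rfl
  rw [e3]
  simp only [sub_mul, Finset.sum_sub_distrib, e1, ← Finset.mul_sum, e2,
    Finset.sum_const, hcard0, hcard1, nsmul_eq_mul]
  generalize ∑ i ∈ Finset.univ.filter (fun i => s i = 1), v i = A
  generalize ∑ i ∈ Finset.univ.filter (fun i => s i = 0), v i = B
  field_simp
  rw [hS]
  ring
end

section
/- For every μ > 0 and every t ∈ ℝ, the smoothed-step function φ_μ(t) = 1 − m_μ(1 − m_μ(t + 1/2)), where m_μ(u) = (1/2)·(u + √(u² + μ)), satisfies | φ_μ(t) − min{ max{t + 1/2, 0}, 1 } | ≤ √μ. -/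
/-- The smoothed max function with smoothing parameter μ > 0. -/
noncomputable def smoothedMax (μ t : ℝ) : ℝ := (1/2) * (t + Real.sqrt (t^2 + μ))

/-- The smoothed-step function with smoothing parameter μ > 0, obtained by
smoothing both max operations in the piecewise-affine approximation of the
step function. -/
noncomputable def smoothedStep (μ t : ℝ) : ℝ :=
  1 - smoothedMax μ (1 - smoothedMax μ (t + 1/2))

theorem smoothedMax_bounds (μ : ℝ) (hμ : 0 < μ) (u : ℝ) :
    max u 0 ≤ smoothedMax μ u ∧ smoothedMax μ u ≤ max u 0 + Real.sqrt μ / 2 := by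
  have h1 : |u| ≤ Real.sqrt (u^2 + μ) := Real.abs_le_sqrt (by linarith)
  have h2 : Real.sqrt (u^2 + μ) ≤ |u| + Real.sqrt μ := by
    apply Real.sqrt_le_iff.mpr
    refine ⟨by positivity, ?_⟩
    have h3 := Real.sq_sqrt hμ.le
    have h4 : 0 ≤ |u| * Real.sqrt μ := by positivity
    nlinarith [sq_abs u]
  unfold smoothedMax
  rcases le_total u 0 with h | h
  · rw [max_eq_right h]
    rw [abs_of_nonpos h] at h1 h2
    constructor <;> linarith
  · rw [max_eq_left h]
    rw [abs_of_nonneg h] at h1 h2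
    constructor <;> linarith

/-- The smoothed-step function is within √μ of the piecewise-affine
approximation t ↦ min{max{t + 1/2, 0}, 1} of the step function. -/
theorem smoothedStep_approx (μ : ℝ) (hμ : 0 < μ) (t : ℝ) :
    |smoothedStep μ t - min (max (t + 1/2) 0) 1| ≤ Real.sqrt μ := by
  unfold smoothedStep
  obtain ⟨a1, a2⟩ := smoothedMax_bounds μ hμ (t + 1/2)
  obtain ⟨b1, b2⟩ := smoothedMax_bounds μ hμ (1 - smoothedMax μ (t + 1/2))
  generalize smoothedMax μ (1 - smoothedMax μ (t + 1/2)) = y at *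
  generalize smoothedMax μ (t + 1/2) = x at *
  generalize max (t + 1/2) 0 = w at *
  have hs := Real.sqrt_nonneg μ
  rw [abs_le]
  rcases le_total (1 - x) 0 with h | h <;> rcases le_total w 1 with h' | h' <;>
    simp only [h, h', max_eq_left, max_eq_right, min_eq_left, min_eq_right] at b1 b2 ⊢ <;>
    constructor <;> linarith
end

section
/- For every μ > 0 and every t ∈ ℝ, the smoothed-step function φ_μ(t) = 1 − m_μ(1 − m_μ(t + 1/2)), where m_μ(u) = (1/2)·(u + √(u² + μ)), satisfies (1 − √(1 + μ))/2 < φ_μ(t) < 1; in particular φ_μ is a bounded function on ℝ. -/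
theorem smoothedMax_pos_aux (μ : ℝ) (hμ : 0 < μ) (u : ℝ) : 0 < smoothedMax μ u := by
  unfold smoothedMax
  have h : -u < Real.sqrt (u^2 + μ) := Real.lt_sqrt_of_sq_lt (by nlinarith)
  linarith

/-- For μ > 0, the smoothed-step function takes values strictly between
(1 − √(1 + μ))/2 and 1; in particular it is bounded. -/
theorem smoothedStep_bounds (μ : ℝ) (hμ : 0 < μ) (t : ℝ) :
    (1 - Real.sqrt (1 + μ)) / 2 < smoothedStep μ t ∧ smoothedStep μ t < 1 := by
  have ha := smoothedMax_pos_aux μ hμ (t + 1/2)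
  refine ⟨?_, ?_⟩
  · unfold smoothedStep
    generalize smoothedMax μ (t + 1/2) = a at ha
    unfold smoothedMax
    have hr : 0 ≤ Real.sqrt (1 + μ) := Real.sqrt_nonneg _
    have hr2 : Real.sqrt (1 + μ) ^ 2 = 1 + μ := Real.sq_sqrt (by linarith)
    have h : Real.sqrt ((1 - a)^2 + μ) < Real.sqrt (1 + μ) + a := by
      rw [Real.sqrt_lt' (by linarith)]
      nlinarith [mul_nonneg hr ha.le]
    linarith
  · have h := smoothedMax_pos_aux μ hμ (1 - smoothedMax μ (t + 1/2))
    unfold smoothedStep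
    linarith
end

section
/- Fix μ > 0 and let φ_μ(t) = 1 − m_μ(1 − m_μ(t + 1/2)), where m_μ(u) = (1/2)·(u + √(u² + μ)). Then for any fixed t > 0, the scaled value φ_μ(α·t) converges to 1 as α → ∞, and for any fixed t < 0, the scaled value φ_μ(α·t) converges to (1 − √(1 + μ))/2 as α → ∞. -/
open Filter Topology in
lemma smoothedMax_atBot (μ : ℝ) (hμ : 0 < μ) : Tendsto (smoothedMax μ) atBot (𝓝 0) := by
  have h1 : Tendsto (fun u : ℝ => (μ / 2) / (-u)) atBot (𝓝 0) :=
    tendsto_const_nhds.div_atTop tendsto_neg_atBot_atTop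
  refine tendsto_of_tendsto_of_tendsto_of_le_of_le' tendsto_const_nhds h1 ?_ ?_
  · filter_upwards with u
    have : -u ≤ Real.sqrt (u^2 + μ) := Real.le_sqrt_of_sq_le (by nlinarith)
    unfold smoothedMax
    linarith
  · filter_upwards [eventually_lt_atBot (0:ℝ)] with u hu
    rw [le_div_iff₀ (by linarith)]
    have h2 : -u ≤ Real.sqrt (u^2 + μ) := Real.le_sqrt_of_sq_le (by nlinarith)
    have h3 : Real.sqrt (u^2 + μ) ^ 2 = u^2 + μ := Real.sq_sqrt (by positivity)
    unfold smoothedMax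
    nlinarith

open Filter Topology in
lemma smoothedMax_atTop (μ : ℝ) : Tendsto (smoothedMax μ) atTop atTop := by
  have h1 : Tendsto (fun u : ℝ => (1/2) * u) atTop atTop :=
    tendsto_id.const_mul_atTop (by norm_num)
  refine tendsto_atTop_mono (fun u => ?_) h1
  unfold smoothedMax
  have := Real.sqrt_nonneg (u^2 + μ)
  linarith

lemma smoothedMax_continuous (μ : ℝ) : Continuous (smoothedMax μ) := by
  unfold smoothedMax
  fun_prop

/-- For fixed μ > 0, the scaled smoothed-step function φ_μ(α·t) converges, as
α → ∞, to 1 when t > 0 and to (1 − √(1 + μ))/2 when t < 0. -/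
theorem smoothedStep_scaled_limits (μ : ℝ) (hμ : 0 < μ) (t : ℝ) :
    (0 < t → Filter.Tendsto (fun α : ℝ => smoothedStep μ (α * t))
        Filter.atTop (nhds 1)) ∧
    (t < 0 → Filter.Tendsto (fun α : ℝ => smoothedStep μ (α * t))
        Filter.atTop (nhds ((1 - Real.sqrt (1 + μ)) / 2))) := by
  constructor
  · intro ht
    have h1 : Filter.Tendsto (fun α : ℝ => α * t + 1/2) Filter.atTop Filter.atTop :=
      Filter.tendsto_atTop_add_const_right _ _ (Filter.tendsto_id.atTop_mul_const ht)
    have h2 := (smoothedMax_atTop μ).comp h1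
    have h3 := Filter.tendsto_atBot_add_const_left _ (1:ℝ)
      (Filter.tendsto_neg_atTop_atBot.comp h2)
    have h4 := ((smoothedMax_atBot μ hμ).comp h3).const_sub 1
    rw [sub_zero] at h4
    exact h4
  · intro ht
    have h1 : Filter.Tendsto (fun α : ℝ => α * t + 1/2) Filter.atTop Filter.atBot :=
      Filter.tendsto_atBot_add_const_right _ _ (Filter.tendsto_id.atTop_mul_const_of_neg ht)
    have h2 := ((smoothedMax_atBot μ hμ).comp h1).const_sub 1
    have h4 := (((smoothedMax_continuous μ).tendsto _).comp h2).const_sub 1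
    have h5 : 1 - smoothedMax μ (1 - 0) = (1 - Real.sqrt (1 + μ)) / 2 := by
      unfold smoothedMax
      norm_num
      ring
    rw [h5] at h4
    exact h4
end
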